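/- Let k ∈ {0,1,2} and let A, B : [t₀,∞) → M_m(ℝ) be continuous. The system ẍ + A(t)ẋ + B(t)x = 0 is L_k-equivalent to some system ξ̈ + V(t)ξ̇ + W(t)ξ = 0 with V, W continuous and W(t) = W(t)ᵀ for all t ≥ t₀ if and only if there exist a symmetric C¹ matrix function S : [t₀,∞) → M_m(ℝ), a symmetric positive definite S₀ ∈ M_m(ℝ), and a skew-symmetric C¹ matrix function K : [t₀,∞) → M_m(ℝ) satisfying the matrix differential equation 2K̇(t) + A(t)K(t) + K(t)A(t)ᵀ + A(t)S(t) − S(t)A(t)ᵀ + B(t)Λ(t) − Λ(t)B(t)ᵀ = 0 with Λ(t) = 2∫_{t₀}^t S(ν) dν + S₀, together with: (1) there exist μ > 0, η > 0 with |tr(Λ(t))| ≤ μ² and det(Λ(t)) ≥ η² for all t ≥ t₀; (2) if k ≥ 1, then sup_{t≥t₀} ‖(d^i/dt^i)K(t)‖ + sup_{t≥t₀} ‖(d^i/dt^i)S(t)‖ < ∞ for every 0 ≤ i ≤ k−1. -/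

import Mathlib

open Matrix Set intervalIntegral

attribute [local instance] Matrix.frobeniusNormedAddCommGroup Matrix.frobeniusNormedSpace

/-- An `L_k`-matrix on `[t₀,∞)`: a `C²` matrix function with `|det L(t)| ≥ η > 0` and
`sup_{t ≥ t₀} ‖(dⁱ/dtⁱ)L(t)‖ < ∞` for every `0 ≤ i ≤ k`. -/
def IsLkMatrix (t₀ : ℝ) (k : ℕ) {m : ℕ} (L : ℝ → Matrix (Fin m) (Fin m) ℝ) : Prop :=
  ContDiffOn ℝ 2 L (Ici t₀) ∧
  (∃ η > (0:ℝ), ∀ t ∈ Ici t₀, η ≤ |(L t).det|) ∧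
  (∀ i ≤ k, ∃ M : ℝ, ∀ t ∈ Ici t₀, ‖iteratedDerivWithin i L (Ici t₀) t‖ ≤ M)

/-- The system `ẍ + A(t)ẋ + B(t)x = 0` is `L_k`-equivalent to `ξ̈ + V(t)ξ̇ + W(t)ξ = 0`:
there is an `L_k`-matrix `L` with `V(t) = L(t)⁻¹(2L̇(t) + A(t)L(t))` and
`W(t) = L(t)⁻¹(L̈(t) + A(t)L̇(t) + B(t)L(t))` for all `t ≥ t₀`. -/
def LkEquiv (t₀ : ℝ) (k : ℕ) {m : ℕ} (A B V W : ℝ → Matrix (Fin m) (Fin m) ℝ) : Prop :=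
  ∃ L : ℝ → Matrix (Fin m) (Fin m) ℝ, IsLkMatrix t₀ k L ∧
    ∀ t ∈ Ici t₀,
      V t = (L t)⁻¹ * ((2:ℝ) • derivWithin L (Ici t₀) t + A t * L t) ∧
      W t = (L t)⁻¹ * (derivWithin (derivWithin L (Ici t₀)) (Ici t₀) t
              + A t * derivWithin L (Ici t₀) t + B t * L t)

/-- `Λ(t) = 2∫_{t₀}^t S(ν) dν + S₀`. -/
noncomputable def Lam (t₀ : ℝ) {m : ℕ} (S : ℝ → Matrix (Fin m) (Fin m) ℝ)
    (S₀ : Matrix (Fin m) (Fin m) ℝ) (t : ℝ) : Matrix (Fin m) (Fin m) ℝ :=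
  (2:ℝ) • (∫ ν in t₀..t, S ν) + S₀


section LinearODE

/-- The retraction of a normed space onto the ball of radius `R`, written as
`x ↦ (R / max R ‖x‖) • x`. -/
noncomputable def ballRetract {E : Type*} [NormedAddCommGroup E] [NormedSpace ℝ E]
    (R : ℝ) (x : E) : E := (R / max R ‖x‖) • x

variable {E : Type*} [NormedAddCommGroup E] [NormedSpace ℝ E] {R : ℝ}

lemma ballRetract_of_norm_le (hR : 0 < R) {x : E} (hx : ‖x‖ ≤ R) : ballRetract R x = x := by
  rw [ballRetract, max_eq_left hx, div_self hR.ne', one_smul]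

lemma norm_ballRetract_le (hR : 0 < R) (x : E) : ‖ballRetract R x‖ ≤ R := by
  have h : 0 < max R ‖x‖ := lt_max_of_lt_left hR
  rw [ballRetract, norm_smul, Real.norm_of_nonneg (by positivity), div_mul_eq_mul_div, div_le_iff₀ h]
  gcongr
  exact le_max_right _ _

lemma norm_ballRetract_le_norm (hR : 0 < R) (x : E) : ‖ballRetract R x‖ ≤ ‖x‖ := by
  have h : 0 < max R ‖x‖ := lt_max_of_lt_left hR
  rw [ballRetract, norm_smul, Real.norm_of_nonneg (by positivity)]
  exact mul_le_of_le_one_left (norm_nonneg _) ((div_le_one h).2 (le_max_left _ _))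

lemma norm_ballRetract_sub_le (hR : 0 < R) (x y : E) :
    ‖ballRetract R x - ballRetract R y‖ ≤ 2 * ‖x - y‖ := by
  set p := max R ‖x‖ with hp
  set q := max R ‖y‖ with hq
  have hp0 : 0 < p := lt_max_of_lt_left hR
  have hq0 : 0 < q := lt_max_of_lt_left hR
  have hpR : R ≤ p := le_max_left _ _
  have hqy : ‖y‖ ≤ q := le_max_right _ _
  have hpq : |q - p| ≤ ‖x - y‖ := by
    rw [abs_sub_comm, hp, hq, max_comm R, max_comm R]
    exact (abs_max_sub_max_le_abs _ _ _).trans (abs_norm_sub_norm_le x y)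
  have key : ballRetract R x - ballRetract R y
      = (R / p) • (x - y) + (R / p * ((q - p) / q)) • y := by
    rw [ballRetract, ballRetract, ← hp, ← hq, smul_sub, sub_add, ← sub_smul]
    congr 2
    field_simp
    ring
  have h1 : R / p ≤ 1 := (div_le_one hp0).2 hpR
  have h0 : 0 ≤ R / p := by positivity
  calc ‖ballRetract R x - ballRetract R y‖
      ≤ R / p * ‖x - y‖ + R / p * (|q - p| * (‖y‖ / q)) := by
        rw [key]
        refine (norm_add_le _ _).trans (le_of_eq ?_)
        rw [norm_smul, norm_smul, Real.norm_of_nonneg h0, norm_mul, Real.norm_of_nonneg h0,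
          norm_div, Real.norm_eq_abs, Real.norm_of_nonneg hq0.le]
        ring
    _ ≤ 1 * ‖x - y‖ + 1 * (‖x - y‖ * 1) := by
        gcongr
        exact (div_le_one hq0).2 hqy
    _ = 2 * ‖x - y‖ := by ring

variable {𝔸 : Type*} [NormedRing 𝔸] [NormedAlgebra ℝ 𝔸]

lemma hasDerivWithinAt_Ici_of_Icc {x : ℝ → E} {x' : E} {a b t : ℝ} (h : HasDerivWithinAt x x' (Icc a b) t) (ht : t ∈ Ico a b) :
    HasDerivWithinAt x x' (Ici t) t :=
  h.mono_of_mem_nhdsWithin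
    (Filter.mem_of_superset (Icc_mem_nhdsGE ht.2) (Icc_subset_Icc_left ht.1))

/-- On a compact interval a linear equation `ẋ = q(t) x` in a Banach algebra is solvable. -/
lemma exists_linear_ode_solution_Icc [CompleteSpace 𝔸] {q : ℝ → 𝔸} {a b : ℝ} (hab : a ≤ b)
    (hq : ContinuousOn q (Icc a b)) (x₀ : 𝔸) :
    ∃ x : ℝ → 𝔸, x a = x₀ ∧ ∀ t ∈ Icc a b, HasDerivWithinAt x (q t * x t) (Icc a b) t := by
  obtain ⟨C, hC⟩ := isCompact_Icc.exists_bound_of_continuousOn hq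
  have hC0 : 0 ≤ C := (norm_nonneg _).trans (hC a (left_mem_Icc.2 hab))
  set R : ℝ := ‖x₀‖ * Real.exp (C * (b - a)) + 1
  have hR : 0 < R := by positivity
  have hba : 0 ≤ b - a := sub_nonneg.2 hab
  have hPL : IsPicardLindelof (fun t x ↦ q t * ballRetract R x) (⟨a, left_mem_Icc.2 hab⟩ : Icc a b)
      x₀ ⟨C * R * (b - a), by positivity⟩ 0 ⟨C * R, by positivity⟩ ⟨C * 2, by positivity⟩ := by
    refine ⟨fun t ht ↦ LipschitzOnWith.of_dist_le_mul fun x _ y _ ↦ ?_, fun x _ ↦ ?_,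
      fun t ht x _ ↦ ?_, ?_⟩
    · rw [dist_eq_norm, dist_eq_norm, ← mul_sub]
      refine (norm_mul_le _ _).trans ?_
      change _ ≤ C * 2 * _
      rw [mul_assoc]
      exact mul_le_mul (hC t ht) (norm_ballRetract_sub_le hR x y) (norm_nonneg _) hC0
    · exact hq.mul continuousOn_const
    · exact (norm_mul_le _ _).trans
        (mul_le_mul (hC t ht) (norm_ballRetract_le hR x) (norm_nonneg _) hC0)
    · change C * R * max (b - a) (a - a) ≤ C * R * (b - a) - 0
      simp [hba]
  obtain ⟨x, hxa, hx⟩ := hPL.exists_eq_forall_mem_Icc_hasDerivWithinAt₀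
  refine ⟨x, hxa, fun t ht ↦ ?_⟩
  have hbound : ‖x t‖ ≤ R := by
    have h := norm_le_gronwallBound_of_norm_deriv_right_le (K := C) (ε := 0)
      (fun s hs ↦ (hx s hs).continuousWithinAt)
      (fun s hs ↦ hasDerivWithinAt_Ici_of_Icc (hx s (Ico_subset_Icc_self hs)) hs)
      (le_of_eq (congrArg norm hxa)) (fun s hs ↦ ?_) t ht
    · rw [gronwallBound_ε0] at h
      refine h.trans (le_add_of_le_of_nonneg ?_ zero_le_one)
      gcongr
      exact ht.2
    · rw [add_zero]
      exact (norm_mul_le _ _).trans (mul_le_mul (hC s (Ico_subset_Icc_self hs))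
        (norm_ballRetract_le_norm hR _) (norm_nonneg _) hC0)
  simpa only [ballRetract_of_norm_le hR hbound] using hx t ht

/-- A linear equation `ẋ = q(t) x` in a Banach algebra is solvable on a whole half-line. -/
lemma exists_linear_ode_solution_Ici [CompleteSpace 𝔸] {q : ℝ → 𝔸} {a : ℝ}
    (hq : ContinuousOn q (Ici a)) (x₀ : 𝔸) :
    ∃ x : ℝ → 𝔸, x a = x₀ ∧ ∀ t ∈ Ici a, HasDerivWithinAt x (q t * x t) (Ici a) t := by
  have hab (n : ℕ) : a ≤ a + n := le_add_of_nonneg_right n.cast_nonneg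
  choose x hxa hx using fun n : ℕ ↦
    exists_linear_ode_solution_Icc (hab n) (hq.mono Icc_subset_Ici_self) x₀
  have agree {n k : ℕ} (hnk : n ≤ k) : ∀ t ∈ Icc a (a + n), x n t = x k t := by
    obtain ⟨C, hC⟩ := isCompact_Icc.exists_bound_of_continuousOn
      (hq.mono (Icc_subset_Ici_self : Icc a (a + n) ⊆ _))
    have hsub : Icc a (a + (n : ℝ)) ⊆ Icc a (a + (k : ℝ)) :=
      Icc_subset_Icc_right (by gcongr)
    have hd (t) (ht : t ∈ Icc a (a + (n : ℝ))) : HasDerivWithinAt (fun t ↦ x n t - x k t)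
        (q t * x n t - q t * x k t) (Icc a (a + n)) t :=
      (hx n t ht).sub ((hx k t (hsub ht)).mono hsub)
    intro t ht
    refine sub_eq_zero.1 (eq_zero_of_abs_deriv_le_mul_abs_self_of_eq_zero_right (K := C)
      (fun s hs ↦ (hd s hs).continuousWithinAt)
      (fun s hs ↦ hasDerivWithinAt_Ici_of_Icc (hd s (Ico_subset_Icc_self hs)) hs)
      (by simp [hxa]) (fun s hs ↦ ?_) t ht)
    rw [← mul_sub]
    exact (norm_mul_le _ _).trans
      (mul_le_mul_of_nonneg_right (hC s (Ico_subset_Icc_self hs)) (norm_nonneg _))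
  set y : ℝ → 𝔸 := fun t ↦ x ⌈t - a⌉₊ t
  have hy (n : ℕ) : ∀ t ∈ Icc a (a + n), y t = x n t := fun t ht ↦
    agree (Nat.ceil_le.2 (by linarith [ht.2])) t ⟨ht.1, by linarith [Nat.le_ceil (t - a)]⟩
  refine ⟨y, by simp [y, hxa], fun t (ht : a ≤ t) ↦ ?_⟩
  obtain ⟨n, hn⟩ := exists_nat_gt (t - a)
  have htn : t ∈ Icc a (a + (n : ℝ)) := ⟨ht, by linarith⟩
  have h := (hx n t htn).congr (hy n) (hy n t htn)
  rw [← hy n t htn] at h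
  refine h.mono_of_mem_nhdsWithin ?_
  rw [← Ici_inter_Iic]
  exact Filter.inter_mem self_mem_nhdsWithin
    (mem_nhdsWithin_of_mem_nhds (Iic_mem_nhds (by linarith)))

end LinearODE

/-- A function vanishing at `a` whose derivative on `[a,∞)` is locally uniformly dominated by the
function itself vanishes identically. -/
lemma eq_zero_of_norm_hasDerivWithinAt_Ici_le {E : Type*} [NormedAddCommGroup E] [NormedSpace ℝ E]
    {x x' : ℝ → E} {a : ℝ} (hx : ∀ t ∈ Ici a, HasDerivWithinAt x (x' t) (Ici a) t) (ha : x a = 0)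
    (hbound : ∀ b, ∃ C, ∀ t ∈ Icc a b, ‖x' t‖ ≤ C * ‖x t‖) : ∀ t ∈ Ici a, x t = 0 := by
  intro t ht
  obtain ⟨C, hC⟩ := hbound t
  exact eq_zero_of_abs_deriv_le_mul_abs_self_of_eq_zero_right
    (fun s hs ↦ (hx s hs.1).continuousWithinAt.mono Icc_subset_Ici_self)
    (fun s hs ↦ (hx s hs.1).mono (Ici_subset_Ici.2 hs.1)) ha
    (fun s hs ↦ hC s (Ico_subset_Icc_self hs)) t (right_mem_Icc.2 ht)

section MatrixFunctions

variable {m : ℕ} {F G : ℝ → Matrix (Fin m) (Fin m) ℝ} {s : Set ℝ} {t : ℝ}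

lemma HasDerivWithinAt.matrix_mul {F' G' : Matrix (Fin m) (Fin m) ℝ}
    (hF : HasDerivWithinAt F F' s t) (hG : HasDerivWithinAt G G' s t) :
    HasDerivWithinAt (fun t ↦ F t * G t) (F' * G t + F t * G') s t := by
  let : NormedRing (Matrix (Fin m) (Fin m) ℝ) := Matrix.frobeniusNormedRing
  let : NormedAlgebra ℝ (Matrix (Fin m) (Fin m) ℝ) := Matrix.frobeniusNormedAlgebra
  exact HasDerivWithinAt.mul hF hG

lemma HasDerivWithinAt.matrix_transpose {F' : Matrix (Fin m) (Fin m) ℝ}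
    (hF : HasDerivWithinAt F F' s t) : HasDerivWithinAt (fun t ↦ (F t)ᵀ) F'ᵀ s t :=
  ((Matrix.transposeLinearEquiv (Fin m) (Fin m) ℝ
    ℝ).toContinuousLinearEquiv).toContinuousLinearMap.hasFDerivAt.comp_hasDerivWithinAt t hF

lemma ContDiffOn.matrix_mul {n : WithTop ℕ∞} (hF : ContDiffOn ℝ n F s) (hG : ContDiffOn ℝ n G s) :
    ContDiffOn ℝ n (fun t ↦ F t * G t) s := by
  let : NormedRing (Matrix (Fin m) (Fin m) ℝ) := Matrix.frobeniusNormedRing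
  let : NormedAlgebra ℝ (Matrix (Fin m) (Fin m) ℝ) := Matrix.frobeniusNormedAlgebra
  exact ContDiffOn.mul hF hG

lemma ContinuousOn.matrix_mul (hF : ContinuousOn F s) (hG : ContinuousOn G s) :
    ContinuousOn (fun t ↦ F t * G t) s :=
  contDiffOn_zero.1 ((contDiffOn_zero.2 hF).matrix_mul (contDiffOn_zero.2 hG))

lemma ContDiffOn.matrix_transpose {n : WithTop ℕ∞} (hF : ContDiffOn ℝ n F s) :
    ContDiffOn ℝ n (fun t ↦ (F t)ᵀ) s :=
  ((Matrix.transposeLinearEquiv (Fin m) (Fin m) ℝ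
    ℝ).toContinuousLinearEquiv).toContinuousLinearMap.contDiff.comp_contDiffOn hF

lemma ContDiffOn.matrix_inv {n : WithTop ℕ∞} (hF : ContDiffOn ℝ n F s)
    (hdet : ∀ t ∈ s, (F t).det ≠ 0) : ContDiffOn ℝ n (fun t ↦ (F t)⁻¹) s := by
  let : NormedRing (Matrix (Fin m) (Fin m) ℝ) := Matrix.frobeniusNormedRing
  let : NormedAlgebra ℝ (Matrix (Fin m) (Fin m) ℝ) := Matrix.frobeniusNormedAlgebra
  intro t ht
  simp only [Matrix.nonsing_inv_eq_ringInverse]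
  obtain ⟨u, hu⟩ := (Matrix.isUnit_iff_isUnit_det (F t)).2 (hdet t ht).isUnit
  have h := contDiffAt_ringInverse ℝ (n := n) u
  rw [hu] at h
  exact h.comp_contDiffWithinAt t (hF t ht)

lemma continuousOn_matrix_inv {X : Type*} [TopologicalSpace X] {s : Set X}
    {F : X → Matrix (Fin m) (Fin m) ℝ} (hF : ContinuousOn F s)
    (hdet : ∀ t ∈ s, (F t).det ≠ 0) : ContinuousOn (fun t ↦ (F t)⁻¹) s := by
  simp only [Matrix.inv_def, Ring.inverse_eq_inv']
  exact ((continuous_id.matrix_det.comp_continuousOn hF).inv₀ hdet).smul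
    (continuous_id.matrix_adjugate.comp_continuousOn hF)

lemma exists_matrix_linear_ode_solution {q : ℝ → Matrix (Fin m) (Fin m) ℝ} {a : ℝ}
    (hq : ContinuousOn q (Ici a)) (x₀ : Matrix (Fin m) (Fin m) ℝ) :
    ∃ x : ℝ → Matrix (Fin m) (Fin m) ℝ, x a = x₀ ∧
      ∀ t ∈ Ici a, HasDerivWithinAt x (q t * x t) (Ici a) t := by
  let : NormedRing (Matrix (Fin m) (Fin m) ℝ) := Matrix.frobeniusNormedRing
  let : NormedAlgebra ℝ (Matrix (Fin m) (Fin m) ℝ) := Matrix.frobeniusNormedAlgebra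
  exact exists_linear_ode_solution_Ici hq x₀

lemma trace_mul_transpose_self (X : Matrix (Fin m) (Fin m) ℝ) : (X * Xᵀ).trace = ‖X‖ ^ 2 := by
  have h : 0 ≤ ∑ i, ∑ j, ‖X i j‖ ^ (2 : ℝ) := by positivity
  rw [Matrix.frobenius_norm_def, ← Real.sqrt_eq_rpow, Real.sq_sqrt h]
  simp [Matrix.trace, Matrix.mul_apply, pow_two]

open scoped MatrixOrder in
lemma Matrix.PosSemidef.exists_eq_mul_transpose {X : Matrix (Fin m) (Fin m) ℝ}
    (hX : X.PosSemidef) : ∃ Y, X = Y * Yᵀ := by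
  obtain ⟨Y, hY⟩ := CStarAlgebra.nonneg_iff_eq_star_mul_self.mp hX.nonneg
  exact ⟨Yᵀ, by simpa [Matrix.star_eq_conjTranspose] using hY⟩

lemma Matrix.posDef_mul_transpose_self {X : Matrix (Fin m) (Fin m) ℝ} (hX : X.det ≠ 0) :
    (X * Xᵀ).PosDef := by
  have h := Matrix.PosDef.mul_conjTranspose_self X
    (Matrix.vecMul_injective_iff_isUnit.2 ((Matrix.isUnit_iff_isUnit_det X).2 hX.isUnit))
  simpa using h

/-- Boundedness in norm of a matrix function on a set. -/
def NormBoundedOn (F : ℝ → Matrix (Fin m) (Fin m) ℝ) (s : Set ℝ) : Prop :=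
  ∃ M : ℝ, ∀ t ∈ s, ‖F t‖ ≤ M

namespace NormBoundedOn

lemma congr (hF : NormBoundedOn F s) (h : ∀ t ∈ s, G t = F t) : NormBoundedOn G s :=
  hF.imp fun _ hM t ht ↦ h t ht ▸ hM t ht

lemma add (hF : NormBoundedOn F s) (hG : NormBoundedOn G s) :
    NormBoundedOn (fun t ↦ F t + G t) s :=
  let ⟨M, hM⟩ := hF
  let ⟨N, hN⟩ := hG
  ⟨M + N, fun t ht ↦ (norm_add_le _ _).trans (add_le_add (hM t ht) (hN t ht))⟩

lemma sub (hF : NormBoundedOn F s) (hG : NormBoundedOn G s) :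
    NormBoundedOn (fun t ↦ F t - G t) s :=
  let ⟨M, hM⟩ := hF
  let ⟨N, hN⟩ := hG
  ⟨M + N, fun t ht ↦ (norm_sub_le _ _).trans (add_le_add (hM t ht) (hN t ht))⟩

lemma const_smul (hF : NormBoundedOn F s) (c : ℝ) : NormBoundedOn (fun t ↦ c • F t) s :=
  let ⟨M, hM⟩ := hF
  ⟨‖c‖ * M, fun t ht ↦ by
    rw [norm_smul]
    exact mul_le_mul_of_nonneg_left (hM t ht) (norm_nonneg _)⟩

lemma mul (hF : NormBoundedOn F s) (hG : NormBoundedOn G s) :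
    NormBoundedOn (fun t ↦ F t * G t) s :=
  let ⟨M, hM⟩ := hF
  let ⟨N, hN⟩ := hG
  ⟨M * N, fun t ht ↦ (Matrix.frobenius_norm_mul _ _).trans
    (mul_le_mul (hM t ht) (hN t ht) (norm_nonneg _) ((norm_nonneg _).trans (hM t ht)))⟩

lemma transpose (hF : NormBoundedOn F s) : NormBoundedOn (fun t ↦ (F t)ᵀ) s :=
  hF.imp fun _ hM t ht ↦ (Matrix.frobenius_norm_transpose _).trans_le (hM t ht)

lemma inv (hF : NormBoundedOn F s) {η : ℝ} (hη : 0 < η) (hdet : ∀ t ∈ s, η ≤ |(F t).det|) :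
    NormBoundedOn (fun t ↦ (F t)⁻¹) s := by
  obtain ⟨M, hM⟩ := hF
  have hdetc : Continuous fun X : Matrix (Fin m) (Fin m) ℝ ↦ |X.det| :=
    continuous_id.matrix_det.abs
  have hK : IsCompact (Metric.closedBall (0 : Matrix (Fin m) (Fin m) ℝ) M ∩ {X | η ≤ |X.det|}) :=
    (isCompact_closedBall _ _).inter_right (isClosed_le continuous_const hdetc)
  obtain ⟨N, hN⟩ := hK.exists_bound_of_continuousOn
    (continuousOn_matrix_inv continuousOn_id fun X hX ↦ abs_pos.1 (hη.trans_le hX.2))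
  exact ⟨N, fun t ht ↦ hN _ ⟨by simpa using hM t ht, hdet t ht⟩⟩

end NormBoundedOn

end MatrixFunctions

lemma hasDerivWithinAt_Lam {m : ℕ} {t₀ : ℝ} {S : ℝ → Matrix (Fin m) (Fin m) ℝ}
    (hS : ContinuousOn S (Ici t₀)) (S₀ : Matrix (Fin m) (Fin m) ℝ) {t : ℝ} (ht : t ∈ Ici t₀) :
    HasDerivWithinAt (Lam t₀ S S₀) ((2 : ℝ) • S t) (Ici t₀) t := by
  have hc : Continuous fun u ↦ S (max t₀ u) :=
    hS.comp_continuous (by fun_prop) fun u ↦ mem_Ici.2 (le_max_left _ _)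
  have h := (((hc.integral_hasStrictDerivAt t₀ t).hasDerivAt.const_smul (2 : ℝ)).add_const
    S₀).hasDerivWithinAt (s := Ici t₀)
  rw [max_eq_right (mem_Ici.1 ht)] at h
  have heq : ∀ u ∈ Ici t₀, Lam t₀ S S₀ u = (2 : ℝ) • (∫ ν in t₀..u, S (max t₀ ν)) + S₀ := by
    intro u hu
    rw [Lam, integral_congr fun ν hν ↦ ?_]
    rw [uIcc_of_le hu] at hν
    simp [max_eq_right hν.1]
  exact h.congr heq (heq t ht)

lemma contDiffOn_succ_of_hasDerivWithinAt_Ici {E : Type*} [NormedAddCommGroup E] [NormedSpace ℝ E]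
    {n : ℕ} {F F' : ℝ → E} {a : ℝ} (h : ∀ t ∈ Ici a, HasDerivWithinAt F (F' t) (Ici a) t)
    (hF' : ContDiffOn ℝ n F' (Ici a)) : ContDiffOn ℝ (n + 1) F (Ici a) :=
  (contDiffOn_succ_iff_derivWithin (uniqueDiffOn_Ici a)).2
    ⟨fun t ht ↦ (h t ht).differentiableWithinAt, by simp,
      hF'.congr fun t ht ↦ (h t ht).derivWithin (uniqueDiffOn_Ici a t ht)⟩

lemma ContDiffOn.hasDerivWithinAt_derivWithin {E : Type*} [NormedAddCommGroup E]
    [NormedSpace ℝ E] {n : WithTop ℕ∞} {F : ℝ → E} {s : Set ℝ} {t : ℝ} (hF : ContDiffOn ℝ n F s)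
    (hn : n ≠ 0) (ht : t ∈ s) : HasDerivWithinAt F (derivWithin F s t) s t :=
  (hF.differentiableOn hn t ht).hasDerivWithinAt

lemma ContDiffOn.derivWithin_Ici {E : Type*} [NormedAddCommGroup E] [NormedSpace ℝ E]
    {F : ℝ → E} {a : ℝ} (hF : ContDiffOn ℝ 2 F (Ici a)) :
    ContDiffOn ℝ 1 (derivWithin F (Ici a)) (Ici a) :=
  hF.derivWithin (uniqueDiffOn_Ici a) (by norm_num)

section Algebra

variable {m : ℕ}

lemma transpose_inv_mul_eq_iff {L Y : Matrix (Fin m) (Fin m) ℝ} (hL : L.det ≠ 0) :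
    (L⁻¹ * Y)ᵀ = L⁻¹ * Y ↔ (Y * Lᵀ)ᵀ = Y * Lᵀ := by
  have hu : IsUnit L.det := hL.isUnit
  have hut : IsUnit Lᵀ.det := by rwa [Matrix.det_transpose]
  have hY : Y * Lᵀ = L * (L⁻¹ * Y) * Lᵀ := by rw [Matrix.mul_nonsing_inv_cancel_left _ _ hu]
  constructor
  · intro h
    rw [hY, Matrix.transpose_mul, Matrix.transpose_mul, h, Matrix.transpose_transpose]
    simp only [Matrix.mul_assoc]
  · intro h
    have hW : L⁻¹ * Y = L⁻¹ * (Y * Lᵀ) * Lᵀ⁻¹ := by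
      rw [Matrix.mul_assoc, Matrix.mul_nonsing_inv_cancel_right _ _ hut]
    rw [hW, Matrix.transpose_mul, Matrix.transpose_mul, h, Matrix.transpose_nonsing_inv,
      Matrix.transpose_nonsing_inv, Matrix.transpose_transpose]
    simp only [Matrix.mul_assoc]

/-- With `S + K = L̇Lᵀ` and `S - K = LL̇ᵀ`, the matrix equation says that `(L̈ + AL̇ + BL)Lᵀ` is
symmetric. -/
lemma matrix_equation_iff_symm {A B S K K' L L' L'' : Matrix (Fin m) (Fin m) ℝ}
    (hadd : S + K = L' * Lᵀ) (hsub : S - K = L * L'ᵀ)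
    (hK' : (2 : ℝ) • K' = L'' * Lᵀ - L * L''ᵀ) :
    (2 : ℝ) • K' + A * K + K * Aᵀ + A * S - S * Aᵀ + B * (L * Lᵀ) - L * Lᵀ * Bᵀ = 0 ↔
      ((L'' + A * L' + B * L) * Lᵀ)ᵀ = (L'' + A * L' + B * L) * Lᵀ := by
  have h : (2 : ℝ) • K' + A * K + K * Aᵀ + A * S - S * Aᵀ + B * (L * Lᵀ) - L * Lᵀ * Bᵀ =
      (L'' + A * L' + B * L) * Lᵀ - ((L'' + A * L' + B * L) * Lᵀ)ᵀ := by
    calc _ = (2 : ℝ) • K' + A * (S + K) + B * (L * Lᵀ) - ((S - K) * Aᵀ + L * Lᵀ * Bᵀ) := by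
          noncomm_ring
      _ = _ := by
          rw [hadd, hsub, hK']
          simp only [Matrix.transpose_mul, Matrix.transpose_add, Matrix.transpose_transpose]
          noncomm_ring
  rw [h, sub_eq_zero, eq_comm]

end Algebra

section SecondOrder

variable {m : ℕ} {s : Set ℝ} {t : ℝ} {L L' : ℝ → Matrix (Fin m) (Fin m) ℝ}
  {L'' : Matrix (Fin m) (Fin m) ℝ}

lemma hasDerivWithinAt_deriv_mul_transpose (hL : HasDerivWithinAt L (L' t) s t)
    (hL' : HasDerivWithinAt L' L'' s t) :
    HasDerivWithinAt (fun t ↦ L' t * (L t)ᵀ) (L'' * (L t)ᵀ + L' t * (L' t)ᵀ) s t :=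
  hL'.matrix_mul hL.matrix_transpose

lemma hasDerivWithinAt_mul_deriv_transpose (hL : HasDerivWithinAt L (L' t) s t)
    (hL' : HasDerivWithinAt L' L'' s t) :
    HasDerivWithinAt (fun t ↦ L t * (L' t)ᵀ) (L' t * (L' t)ᵀ + L t * L''ᵀ) s t :=
  hL.matrix_mul hL'.matrix_transpose

end SecondOrder

/-- solvability of the ENPS problem.  For `k ∈ {0,1,2}` and `A, B`
continuous, the system `ẍ + A(t)ẋ + B(t)x = 0` is `L_k`-equivalent to some system
`ξ̈ + V(t)ξ̇ + W(t)ξ = 0` with `V, W` continuous and `W(t)` symmetric iff there are a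
symmetric `C¹` matrix function `S`, a symmetric positive definite `S₀`, and a
skew-symmetric `C¹` matrix function `K` with
`2K̇ + AK + KAᵀ + AS − SAᵀ + BΛ − ΛBᵀ = 0` on `[t₀,∞)`, where `Λ(t) = 2∫_{t₀}^t S + S₀`,
such that (1) `|tr Λ(t)| ≤ μ²` and `det Λ(t) ≥ η²` on `[t₀,∞)` for some `μ, η > 0`, and
(2) if `k ≥ 1`, the derivatives of `K` and `S` of order `< k` are bounded on `[t₀,∞)`. -/
theorem stmt_4 {m : ℕ} (t₀ : ℝ) (k : ℕ) (hk : k = 0 ∨ k = 1 ∨ k = 2)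
    (A B : ℝ → Matrix (Fin m) (Fin m) ℝ)
    (hA : ContinuousOn A (Ici t₀)) (hB : ContinuousOn B (Ici t₀)) :
    (∃ V W : ℝ → Matrix (Fin m) (Fin m) ℝ,
        ContinuousOn V (Ici t₀) ∧ ContinuousOn W (Ici t₀) ∧
        (∀ t ∈ Ici t₀, (W t)ᵀ = W t) ∧ LkEquiv t₀ k A B V W) ↔
      (∃ S K : ℝ → Matrix (Fin m) (Fin m) ℝ, ∃ S₀ : Matrix (Fin m) (Fin m) ℝ,
        ContDiffOn ℝ 1 S (Ici t₀) ∧ (∀ t ∈ Ici t₀, (S t)ᵀ = S t) ∧ S₀.PosDef ∧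
        ContDiffOn ℝ 1 K (Ici t₀) ∧ (∀ t ∈ Ici t₀, (K t)ᵀ = -K t) ∧
        (∀ t ∈ Ici t₀,
          (2:ℝ) • derivWithin K (Ici t₀) t + A t * K t + K t * (A t)ᵀ
            + A t * S t - S t * (A t)ᵀ
            + B t * Lam t₀ S S₀ t - Lam t₀ S S₀ t * (B t)ᵀ = 0) ∧
        (∃ μ > (0:ℝ), ∃ η > (0:ℝ),
          (∀ t ∈ Ici t₀, |(Lam t₀ S S₀ t).trace| ≤ μ ^ 2) ∧
          (∀ t ∈ Ici t₀, η ^ 2 ≤ (Lam t₀ S S₀ t).det)) ∧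
        (1 ≤ k → ∀ i < k,
          (∃ M : ℝ, ∀ t ∈ Ici t₀, ‖iteratedDerivWithin i K (Ici t₀) t‖ ≤ M) ∧
          (∃ M : ℝ, ∀ t ∈ Ici t₀, ‖iteratedDerivWithin i S (Ici t₀) t‖ ≤ M))) := by
  have huniq : UniqueDiffOn ℝ (Ici t₀) := uniqueDiffOn_Ici t₀
  constructor
  · rintro ⟨V, W, -, -, hWsymm, L, ⟨hL, ⟨η, hη, hdet⟩, hbd⟩, hVW⟩
    set L' := derivWithin L (Ici t₀) with hL'
    set L'' := derivWithin L' (Ici t₀) with hL''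
    have hL'c : ContDiffOn ℝ 1 L' (Ici t₀) := hL.derivWithin_Ici
    have hL1 : ContDiffOn ℝ 1 L (Ici t₀) := hL.of_le (by norm_num)
    have hdL (t) (ht : t ∈ Ici t₀) : HasDerivWithinAt L (L' t) (Ici t₀) t :=
      hL.hasDerivWithinAt_derivWithin (by norm_num) ht
    have hdL' (t) (ht : t ∈ Ici t₀) : HasDerivWithinAt L' (L'' t) (Ici t₀) t :=
      hL'c.hasDerivWithinAt_derivWithin (by norm_num) ht
    have hdet0 (t) (ht : t ∈ Ici t₀) : (L t).det ≠ 0 := abs_pos.1 (hη.trans_le (hdet t ht))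
    set P : ℝ → Matrix (Fin m) (Fin m) ℝ := fun t ↦ L' t * (L t)ᵀ with hP
    set Q : ℝ → Matrix (Fin m) (Fin m) ℝ := fun t ↦ L t * (L' t)ᵀ with hQ
    have hPQ (t) : (P t)ᵀ = Q t := by simp [hP, hQ]
    have hQP (t) : (Q t)ᵀ = P t := by simp [hP, hQ]
    have hPc : ContDiffOn ℝ 1 P (Ici t₀) := hL'c.matrix_mul hL1.matrix_transpose
    have hQc : ContDiffOn ℝ 1 Q (Ici t₀) := hL1.matrix_mul hL'c.matrix_transpose
    have hdP (t) (ht : t ∈ Ici t₀) := hasDerivWithinAt_deriv_mul_transpose (hdL t ht) (hdL' t ht)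
    have hdQ (t) (ht : t ∈ Ici t₀) := hasDerivWithinAt_mul_deriv_transpose (hdL t ht) (hdL' t ht)
    set S : ℝ → Matrix (Fin m) (Fin m) ℝ := fun t ↦ (1 / 2 : ℝ) • (P t + Q t) with hS
    set K : ℝ → Matrix (Fin m) (Fin m) ℝ := fun t ↦ (1 / 2 : ℝ) • (P t - Q t) with hK
    have hSc : ContDiffOn ℝ 1 S (Ici t₀) := (hPc.add hQc).const_smul _
    have hKc : ContDiffOn ℝ 1 K (Ici t₀) := (hPc.sub hQc).const_smul _
    have hdS (t) (ht : t ∈ Ici t₀) := ((hdP t ht).add (hdQ t ht)).const_smul (1 / 2 : ℝ)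
    have hdK (t) (ht : t ∈ Ici t₀) := ((hdP t ht).sub (hdQ t ht)).const_smul (1 / 2 : ℝ)
    have hLam : ∀ t ∈ Ici t₀, Lam t₀ S (L t₀ * (L t₀)ᵀ) t = L t * (L t)ᵀ := by
      intro t ht
      refine sub_eq_zero.1 (eq_zero_of_norm_hasDerivWithinAt_Ici_le
        (x := fun t ↦ Lam t₀ S (L t₀ * (L t₀)ᵀ) t - L t * (L t)ᵀ)
        (fun t ht ↦ (hasDerivWithinAt_Lam hSc.continuousOn _ ht).sub
          ((hdL t ht).matrix_mul (hdL t ht).matrix_transpose))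
        (by simp [Lam]) (fun b ↦ ⟨0, fun t _ ↦ ?_⟩) t ht)
      simp [hS, hP, hQ, smul_smul]
    obtain ⟨M, hM⟩ := hbd 0 (Nat.zero_le k)
    simp only [iteratedDerivWithin_zero] at hM
    refine ⟨S, K, L t₀ * (L t₀)ᵀ, hSc, fun t _ ↦ ?_,
      Matrix.posDef_mul_transpose_self (hdet0 t₀ self_mem_Ici), hKc, fun t _ ↦ ?_, fun t ht ↦ ?_,
      ⟨|M| + 1, by positivity, η, hη, fun t ht ↦ ?_, fun t ht ↦ ?_⟩, fun _ i hi ↦ ?_⟩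
    · simp [hS, hPQ, hQP, add_comm]
    · rw [hK, Matrix.transpose_smul, Matrix.transpose_sub, hPQ, hQP, ← smul_neg, neg_sub]
    · rw [hLam t ht]
      refine (matrix_equation_iff_symm (L' := L' t) (L'' := L'' t) ?_ ?_ ?_).2 ?_
      · change (1 / 2 : ℝ) • (P t + Q t) + (1 / 2 : ℝ) • (P t - Q t) = P t
        module
      · change (1 / 2 : ℝ) • (P t + Q t) - (1 / 2 : ℝ) • (P t - Q t) = Q t
        module
      · have h : derivWithin K (Ici t₀) t = _ := (hdK t ht).derivWithin (huniq t ht)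
        rw [h]
        module
      · rw [← transpose_inv_mul_eq_iff (hdet0 t ht), ← (hVW t ht).2]
        exact hWsymm t ht
    · rw [hLam t ht, trace_mul_transpose_self, abs_of_nonneg (by positivity)]
      gcongr
      exact (hM t ht).trans ((le_abs_self M).trans (by linarith))
    · rw [hLam t ht, Matrix.det_mul, Matrix.det_transpose, ← pow_two, ← sq_abs (L t).det]
      gcongr
      exact hdet t ht
    · have hbL : NormBoundedOn L (Ici t₀) := ⟨M, hM⟩
      have hbL' : NormBoundedOn L' (Ici t₀) := by
        have h := hbd 1 (by omega)
        simp only [iteratedDerivWithin_one] at h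
        exact h
      have hi2 : i = 0 ∨ (i = 1 ∧ k = 2) := by omega
      have hbP : NormBoundedOn P (Ici t₀) := hbL'.mul hbL.transpose
      have hbQ : NormBoundedOn Q (Ici t₀) := hbL.mul hbL'.transpose
      obtain rfl | ⟨rfl, rfl⟩ := hi2
      · simp only [iteratedDerivWithin_zero]
        exact ⟨(hbP.sub hbQ).const_smul _, (hbP.add hbQ).const_smul _⟩
      · have hbL'' : NormBoundedOn L'' (Ici t₀) := by
          have h := hbd 2 le_rfl
          simp only [iteratedDerivWithin_succ, iteratedDerivWithin_zero] at h
          exact h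
        have hbP' := (hbL''.mul hbL.transpose).add (hbL'.mul hbL'.transpose)
        have hbQ' := (hbL'.mul hbL'.transpose).add (hbL.mul hbL''.transpose)
        simp only [iteratedDerivWithin_one]
        exact ⟨((hbP'.sub hbQ').const_smul _).congr fun t ht ↦ (hdK t ht).derivWithin (huniq t ht),
          ((hbP'.add hbQ').const_smul _).congr fun t ht ↦ (hdS t ht).derivWithin (huniq t ht)⟩
  · rintro ⟨S, K, S₀, hSc, hSsymm, hS₀, hKc, hKskew, heq, ⟨μ, hμ, η, hη, htr, hdet⟩, hbd⟩
    set Λ := Lam t₀ S S₀ with hΛ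
    have hdΛ (t) (ht : t ∈ Ici t₀) : HasDerivWithinAt Λ ((2 : ℝ) • S t) (Ici t₀) t :=
      hasDerivWithinAt_Lam hSc.continuousOn S₀ ht
    have hΛc : ContDiffOn ℝ 1 Λ (Ici t₀) :=
      (contDiffOn_succ_of_hasDerivWithinAt_Ici (n := 1) hdΛ (hSc.const_smul _)).of_le (by norm_num)
    have hdetΛ (t) (ht : t ∈ Ici t₀) : (Λ t).det ≠ 0 :=
      ((pow_pos hη 2).trans_le (hdet t ht)).ne'
    set q : ℝ → Matrix (Fin m) (Fin m) ℝ := fun t ↦ (S t + K t) * (Λ t)⁻¹ with hq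
    have hqc : ContDiffOn ℝ 1 q (Ici t₀) := (hSc.add hKc).matrix_mul (hΛc.matrix_inv hdetΛ)
    have hqΛ (t) (ht : t ∈ Ici t₀) : q t * Λ t = S t + K t :=
      Matrix.nonsing_inv_mul_cancel_right _ _ (hdetΛ t ht).isUnit
    have hSKT (t) (ht : t ∈ Ici t₀) : (S t + K t)ᵀ = S t - K t := by
      rw [Matrix.transpose_add, hSsymm t ht, hKskew t ht, sub_eq_add_neg]
    obtain ⟨L₀, hL₀⟩ := hS₀.posSemidef.exists_eq_mul_transpose
    obtain ⟨L, hLt₀, hdL₀⟩ := exists_matrix_linear_ode_solution hqc.continuousOn L₀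
    have hΛT (t) (ht : t ∈ Ici t₀) : (Λ t)ᵀ = Λ t := by
      refine sub_eq_zero.1 (eq_zero_of_norm_hasDerivWithinAt_Ici_le (x := fun t ↦ (Λ t)ᵀ - Λ t)
        (fun t ht ↦ (hdΛ t ht).matrix_transpose.sub (hdΛ t ht)) (by simp [hΛ, Lam, hL₀])
        (fun b ↦ ⟨0, fun t ht ↦ ?_⟩) t ht)
      simp [hSsymm t ht.1]
    have hLL : ∀ t ∈ Ici t₀, L t * (L t)ᵀ = Λ t := by
      intro t ht
      refine sub_eq_zero.1 (eq_zero_of_norm_hasDerivWithinAt_Ici_le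
        (x := fun t ↦ L t * (L t)ᵀ - Λ t)
        (fun t ht ↦ ((hdL₀ t ht).matrix_mul (hdL₀ t ht).matrix_transpose).sub (hdΛ t ht))
        (by simp [hΛ, Lam, hLt₀, hL₀]) (fun b ↦ ?_) t ht)
      obtain ⟨C, hC⟩ := isCompact_Icc.exists_bound_of_continuousOn
        (hqc.continuousOn.mono (Icc_subset_Ici_self : Icc t₀ b ⊆ _))
      refine ⟨2 * C, fun t ht ↦ ?_⟩
      have hΛq : Λ t * (q t)ᵀ = S t - K t := by
        have h := Matrix.transpose_mul (q t) (Λ t)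
        rw [hqΛ t ht.1, hSKT t ht.1, hΛT t ht.1] at h
        exact h.symm
      have hid : q t * L t * (L t)ᵀ + L t * (q t * L t)ᵀ - (2 : ℝ) • S t
          = q t * (L t * (L t)ᵀ - Λ t) + (L t * (L t)ᵀ - Λ t) * (q t)ᵀ := by
        rw [Matrix.mul_sub, Matrix.sub_mul, hqΛ t ht.1, hΛq, Matrix.transpose_mul, two_smul]
        noncomm_ring
      rw [hid, two_mul, add_mul]
      refine (norm_add_le _ _).trans (add_le_add ?_ ?_)
      · exact (Matrix.frobenius_norm_mul _ _).trans
          (mul_le_mul_of_nonneg_right (hC t ht) (norm_nonneg _))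
      · refine (Matrix.frobenius_norm_mul _ _).trans ?_
        rw [Matrix.frobenius_norm_transpose, mul_comm]
        exact mul_le_mul_of_nonneg_right (hC t ht) (norm_nonneg _)
    have hL1 : ContDiffOn ℝ 1 L (Ici t₀) := by
      have h : ContDiffOn ℝ (0 : ℕ) (fun t ↦ q t * L t) (Ici t₀) := contDiffOn_zero.2
        (hqc.continuousOn.matrix_mul fun t ht ↦ (hdL₀ t ht).continuousWithinAt)
      simpa using contDiffOn_succ_of_hasDerivWithinAt_Ici hdL₀ h
    have hL : ContDiffOn ℝ 2 L (Ici t₀) := by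
      have h := contDiffOn_succ_of_hasDerivWithinAt_Ici (n := 1) hdL₀ (hqc.matrix_mul hL1)
      simpa [one_add_one_eq_two] using h
    set L' := derivWithin L (Ici t₀) with hL'
    set L'' := derivWithin L' (Ici t₀) with hL''
    have hL'c : ContDiffOn ℝ 1 L' (Ici t₀) := hL.derivWithin_Ici
    have hdL (t) (ht : t ∈ Ici t₀) : HasDerivWithinAt L (L' t) (Ici t₀) t :=
      hL.hasDerivWithinAt_derivWithin (by norm_num) ht
    have hdL' (t) (ht : t ∈ Ici t₀) : HasDerivWithinAt L' (L'' t) (Ici t₀) t :=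
      hL'c.hasDerivWithinAt_derivWithin (by norm_num) ht
    have hadd (t) (ht : t ∈ Ici t₀) : S t + K t = L' t * (L t)ᵀ := by
      have h : L' t = q t * L t := (hdL₀ t ht).derivWithin (huniq t ht)
      rw [h, Matrix.mul_assoc, hLL t ht, hqΛ t ht]
    have hsub (t) (ht : t ∈ Ici t₀) : S t - K t = L t * (L' t)ᵀ := by
      rw [← hSKT t ht, hadd t ht, Matrix.transpose_mul, Matrix.transpose_transpose]
    have hdetL (t) (ht : t ∈ Ici t₀) : η ≤ |(L t).det| := by
      have h := hdet t ht
      rw [← hLL t ht, Matrix.det_mul, Matrix.det_transpose, ← pow_two] at h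
      simpa [abs_of_pos hη] using sq_le_sq.1 h
    have hdet0 (t) (ht : t ∈ Ici t₀) : (L t).det ≠ 0 := abs_pos.1 (hη.trans_le (hdetL t ht))
    have hSK' (t) (ht : t ∈ Ici t₀) : derivWithin S (Ici t₀) t + derivWithin K (Ici t₀) t
        = L'' t * (L t)ᵀ + L' t * (L' t)ᵀ :=
      (huniq t ht).eq_deriv _ ((hSc.hasDerivWithinAt_derivWithin one_ne_zero ht).add
          (hKc.hasDerivWithinAt_derivWithin one_ne_zero ht))
        ((hasDerivWithinAt_deriv_mul_transpose (hdL t ht) (hdL' t ht)).congr hadd (hadd t ht))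
    have hK' (t) (ht : t ∈ Ici t₀) : (2 : ℝ) • derivWithin K (Ici t₀) t
        = L'' t * (L t)ᵀ - L t * (L'' t)ᵀ := by
      have hSmK' : derivWithin S (Ici t₀) t - derivWithin K (Ici t₀) t
          = L' t * (L' t)ᵀ + L t * (L'' t)ᵀ :=
        (huniq t ht).eq_deriv _ ((hSc.hasDerivWithinAt_derivWithin one_ne_zero ht).sub
            (hKc.hasDerivWithinAt_derivWithin one_ne_zero ht))
          ((hasDerivWithinAt_mul_deriv_transpose (hdL t ht) (hdL' t ht)).congr hsub (hsub t ht))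
      calc (2 : ℝ) • derivWithin K (Ici t₀) t
          = (derivWithin S (Ici t₀) t + derivWithin K (Ici t₀) t)
            - (derivWithin S (Ici t₀) t - derivWithin K (Ici t₀) t) := by module
        _ = _ := by
          rw [hSK' t ht, hSmK']
          abel
    have hLinv : ContinuousOn (fun t ↦ (L t)⁻¹) (Ici t₀) :=
      continuousOn_matrix_inv hL.continuousOn hdet0
    have hL''c : ContinuousOn L'' (Ici t₀) := hL'c.continuousOn_derivWithin huniq le_rfl
    refine ⟨fun t ↦ (L t)⁻¹ * ((2 : ℝ) • L' t + A t * L t),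
      fun t ↦ (L t)⁻¹ * (L'' t + A t * L' t + B t * L t),
      hLinv.matrix_mul ((hL'c.continuousOn.const_smul (2 : ℝ)).add (hA.matrix_mul hL.continuousOn)),
      hLinv.matrix_mul ((hL''c.add (hA.matrix_mul hL'c.continuousOn)).add
        (hB.matrix_mul hL.continuousOn)),
      fun t ht ↦ ?_, L, ⟨hL, ⟨η, hη, hdetL⟩, fun i hi ↦ ?_⟩, fun t _ ↦ ⟨rfl, rfl⟩⟩
    · have h := heq t ht
      rw [← hLL t ht] at h
      exact (transpose_inv_mul_eq_iff (hdet0 t ht)).2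
        ((matrix_equation_iff_symm (hadd t ht) (hsub t ht) (hK' t ht)).1 h)
    · have hbL : NormBoundedOn L (Ici t₀) := ⟨μ, fun t ht ↦ by
        have h := htr t ht
        rw [← hLL t ht, trace_mul_transpose_self, abs_of_nonneg (by positivity)] at h
        exact le_of_sq_le_sq h hμ.le⟩
      have hbinv : NormBoundedOn (fun t ↦ ((L t)⁻¹)ᵀ) (Ici t₀) := (hbL.inv hη hdetL).transpose
      have cancel (t) (ht : t ∈ Ici t₀) (X : Matrix (Fin m) (Fin m) ℝ) :
          X = X * (L t)ᵀ * ((L t)⁻¹)ᵀ := by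
        rw [Matrix.mul_assoc, ← Matrix.transpose_mul,
          Matrix.nonsing_inv_mul _ (hdet0 t ht).isUnit, Matrix.transpose_one, Matrix.mul_one]
      obtain rfl | hi0 := Nat.eq_zero_or_pos i
      · simp only [iteratedDerivWithin_zero]
        exact hbL
      obtain ⟨hbK, hbS⟩ := hbd (by omega) 0 (by omega)
      simp only [iteratedDerivWithin_zero] at hbK hbS
      have hbL' : NormBoundedOn L' (Ici t₀) :=
        ((NormBoundedOn.add hbS hbK).mul hbinv).congr fun t ht ↦ by
          rw [hadd t ht, ← cancel t ht]
      obtain rfl | ⟨rfl, rfl⟩ : i = 1 ∨ (i = 2 ∧ k = 2) := by omega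
      · simp only [iteratedDerivWithin_one]
        exact hbL'
      obtain ⟨hbK', hbS'⟩ := hbd (by omega) 1 (by omega)
      simp only [iteratedDerivWithin_one] at hbK' hbS'
      have hbSK' : NormBoundedOn
          (fun t ↦ derivWithin S (Ici t₀) t + derivWithin K (Ici t₀) t) (Ici t₀) :=
        NormBoundedOn.add hbS' hbK'
      have hbL'' : NormBoundedOn L'' (Ici t₀) :=
        ((hbSK'.sub (hbL'.mul hbL'.transpose)).mul hbinv).congr
          fun t ht ↦ by rw [hSK' t ht, add_sub_cancel_right, ← cancel t ht]
      simp only [iteratedDerivWithin_succ, iteratedDerivWithin_zero]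
      exact hbL''
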